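/- Suppose ε_2 ∉ K and that at least one of the following holds: (a) K is of type C, s ≥ 1 and a ∈ K*^{2^s}; (b) K is of type D or of type E with constant m, 1 ≤ s ≤ m − 1 and a ∈ K*^{2^s}. Let n ≥ 1, a ∈ K*, A = K[X]/(X^{2^n} − a) with ḡ the image of X, s = H_n(a), and write a = b^{2^s} with b ∈ K*. Then for every i, j the element ε_s^{ij} + ε_s^{−ij} of K̄ lies in K, and the minimal idempotents of A are exactly: e_0 = (1/2^s)·Σ_{j=0}^{2^s−1} (b^{−1}·ḡ^{2^{n−s}})^j; e_{2^{s−1}} = (1/2^s)·Σ_{j=0}^{2^s−1} (−1)^j·(b^{−1}·ḡ^{2^{n−s}})^j; and e_i = (1/2^s)·Σ_{j=0}^{2^s−1} (ε_s^{ij} + ε_s^{−ij})·(b^{−1}·ḡ^{2^{n−s}})^j for i = 1, 2, …, 2^{s−1} − 1. -/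

import Mathlib

noncomputable section

/-- `x ∈ K̄` lies in (the image of) the base field `K`. -/
def InK (K : Type*) [Field K] (x : AlgebraicClosure K) : Prop :=
  x ∈ Set.range (algebraMap K (AlgebraicClosure K))

/-- Type A: `ε₂ ∈ K` and `εₙ ∈ K` for every `n`. -/
def TypeA (K : Type*) [Field K] (ε : ℕ → AlgebraicClosure K) : Prop :=
  InK K (ε 2) ∧ ∀ n : ℕ, InK K (ε n)

/-- Type B: `ε₂ ∈ K` and there is a unique `m ≥ 2` with `ε_m ∈ K`, `ε_{m+1} ∉ K`. -/
def TypeB (K : Type*) [Field K] (ε : ℕ → AlgebraicClosure K) : Prop :=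
  InK K (ε 2) ∧ ∃! m : ℕ, 2 ≤ m ∧ InK K (ε m) ∧ ¬InK K (ε (m + 1))

/-- Type C: `ε₂ ∉ K` and `εₙ + εₙ⁻¹ ∈ K` for every `n`. -/
def TypeC (K : Type*) [Field K] (ε : ℕ → AlgebraicClosure K) : Prop :=
  ¬InK K (ε 2) ∧ ∀ n : ℕ, InK K (ε n + (ε n)⁻¹)

/-- Type D: `ε₂ ∉ K` and there is a unique `m ≥ 2` with `ε_m + ε_m⁻¹ ∈ K`,
`ε_{m+1} + ε_{m+1}⁻¹ ∉ K` and `ε_{m+1} - ε_{m+1}⁻¹ ∉ K`. -/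
def TypeD (K : Type*) [Field K] (ε : ℕ → AlgebraicClosure K) : Prop :=
  ¬InK K (ε 2) ∧ ∃! m : ℕ, 2 ≤ m ∧ InK K (ε m + (ε m)⁻¹) ∧
    ¬InK K (ε (m + 1) + (ε (m + 1))⁻¹) ∧ ¬InK K (ε (m + 1) - (ε (m + 1))⁻¹)

/-- Type E: `ε₂ ∉ K` and there is a unique `m ≥ 3` with `ε_m - ε_m⁻¹ ∈ K`. -/
def TypeE (K : Type*) [Field K] (ε : ℕ → AlgebraicClosure K) : Prop :=
  ¬InK K (ε 2) ∧ ∃! m : ℕ, 3 ≤ m ∧ InK K (ε m - (ε m)⁻¹)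

/-- Type B with constant `m`. -/
def TypeBc (K : Type*) [Field K] (ε : ℕ → AlgebraicClosure K) (m : ℕ) : Prop :=
  InK K (ε 2) ∧ 2 ≤ m ∧ InK K (ε m) ∧ ¬InK K (ε (m + 1))

/-- Type D with constant `m`. -/
def TypeDc (K : Type*) [Field K] (ε : ℕ → AlgebraicClosure K) (m : ℕ) : Prop :=
  ¬InK K (ε 2) ∧ 2 ≤ m ∧ InK K (ε m + (ε m)⁻¹) ∧
    ¬InK K (ε (m + 1) + (ε (m + 1))⁻¹) ∧ ¬InK K (ε (m + 1) - (ε (m + 1))⁻¹)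

/-- Type E with constant `m`. -/
def TypeEc (K : Type*) [Field K] (ε : ℕ → AlgebraicClosure K) (m : ℕ) : Prop :=
  ¬InK K (ε 2) ∧ 3 ≤ m ∧ InK K (ε m - (ε m)⁻¹)

/-- `a ∈ K_s = K* ∩ (K(ε₂)*)^{2^s}`: `a = α^{2^s}` for some `α ∈ K(ε₂)*`. -/
def MemKs (K : Type*) [Field K] (ε : ℕ → AlgebraicClosure K) (s : ℕ) (a : K) : Prop :=
  ∃ α : AlgebraicClosure K, α ∈ IntermediateField.adjoin K {ε 2} ∧ α ≠ 0 ∧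
    algebraMap K (AlgebraicClosure K) a = α ^ 2 ^ s

/-- A minimal idempotent of a commutative ring: a nonzero idempotent which is not
the sum of two nonzero orthogonal idempotents. -/
def IsMinIdem {A : Type*} [CommRing A] (e : A) : Prop :=
  e ≠ 0 ∧ e * e = e ∧
    ¬∃ e₁ e₂ : A, e₁ ≠ 0 ∧ e₂ ≠ 0 ∧ e₁ * e₁ = e₁ ∧ e₂ * e₂ = e₂ ∧
      e₁ * e₂ = 0 ∧ e = e₁ + e₂

section Auxiliary

open Polynomial IntermediateField

/-- If `-1` is a square in `F` and `a` is not, then `X ^ 2 ^ k - a` is irreducible over `F`. -/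
theorem X_pow_two_pow_sub_C_irreducible.{u} {F : Type u} [Field F] (hi : ∃ i : F, i ^ 2 = -1)
    (k : ℕ) {a : F} (ha : ∀ c : F, c ^ 2 ≠ a) : Irreducible (X ^ 2 ^ k - C a) := by
  induction k generalizing F a with
  | zero => simpa using irreducible_X_sub_C a
  | succ k ih =>
    rw [pow_succ]
    apply X_pow_mul_sub_C_irreducible (X_pow_sub_C_irreducible_of_prime Nat.prime_two ha)
    intro E _ _ x hx
    have hint : IsIntegral F x := not_not.mp fun h ↦ by
      simpa only [degree_zero, degree_X_pow_sub_C Nat.prime_two.pos,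
        WithBot.natCast_ne_bot] using congr_arg degree (hx.symm.trans (dif_neg h))
    obtain ⟨i, hi⟩ := hi
    apply ih ⟨algebraMap F _ i, by rw [← map_pow, hi, map_neg, map_one]⟩
    intro c hc
    apply ha (i * Algebra.norm F c)
    have hnorm : Algebra.norm F (AdjoinSimple.gen F x) = -a := by
      rw [← adjoin.powerBasis_gen hint, Algebra.PowerBasis.norm_gen_eq_coeff_zero_minpoly]
      simp [minpoly_gen, hx]
    rw [mul_pow, hi, ← map_pow, hc, hnorm]
    ring

theorem geom_sum_of_pow_eq_one {F : Type*} [Field F] [DecidableEq F] {x : F} {q : ℕ}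
    (hx : x ^ q = 1) : ∑ j ∈ Finset.range q, x ^ j = if x = 1 then (q : F) else 0 := by
  split_ifs with h
  · simp [h]
  · have := mul_geom_sum x q
    rw [hx, sub_self] at this
    exact (mul_eq_zero.mp this).resolve_left (sub_ne_zero.mpr h)

theorem pow_add_inv_pow_mem {F : Type*} [Field F] (S : Subring F) {z : F} (hz : z ≠ 0)
    (h : z + z⁻¹ ∈ S) (k : ℕ) : z ^ k + z⁻¹ ^ k ∈ S := by
  induction k using Nat.twoStepInduction with
  | zero => simpa using S.add_mem S.one_mem S.one_mem
  | one => simpa using h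
  | more k h0 h1 =>
    have : z ^ (k + 2) + z⁻¹ ^ (k + 2) =
        (z + z⁻¹) * (z ^ (k + 1) + z⁻¹ ^ (k + 1)) - (z ^ k + z⁻¹ ^ k) := by
      have hzz : z * z⁻¹ = 1 := mul_inv_cancel₀ hz
      linear_combination (-(z ^ k + z⁻¹ ^ k)) * hzz
    rw [this]
    exact S.sub_mem (S.mul_mem h h1) h0

/-- A family of ring homomorphisms to a domain which separates points, together with idempotents
cutting out a partition of the family on which idempotents are constant, determines the minimal
idempotents. -/
theorem isMinIdem_iff_of_characters {A Ω ι κ : Type*} [CommRing A] [Field Ω]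
    (ψ : ι → A →+* Ω) (hψ : ∀ z : A, (∀ x, ψ x z = 0) → z = 0) (S : Set κ) (E : κ → A)
    (R : ι → κ → Prop) (hone : ∀ x, ∀ i ∈ S, R x i → ψ x (E i) = 1)
    (hzero : ∀ x, ∀ i ∈ S, ¬R x i → ψ x (E i) = 0)
    (hcover : ∀ x, ∃ i ∈ S, R x i) (hne : ∀ i ∈ S, ∃ x, R x i)
    (hconst : ∀ i ∈ S, ∀ x y, R x i → R y i → ∀ e : A, ψ x e = 1 → ψ y e = 1) (e : A) :
    IsMinIdem e ↔ ∃ i ∈ S, e = E i := by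
  have hval : ∀ (f : A) (x : ι), f * f = f → ψ x f ≠ 0 → ψ x f = 1 := fun f x hf h0 =>
    mul_left_cancel₀ h0 (by rw [← map_mul, hf, mul_one])
  have hexists : ∀ f : A, f ≠ 0 → ∃ x, ψ x f ≠ 0 := fun f hf => by
    by_contra! h
    exact hf (hψ f h)
  have hidem : ∀ i ∈ S, E i * E i = E i := fun i hi => by
    refine sub_eq_zero.mp (hψ _ fun x => ?_)
    by_cases hR : R x i
    · simp [hone x i hi hR]
    · simp [hzero x i hi hR]
  have hEne : ∀ i ∈ S, E i ≠ 0 := fun i hi h0 => by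
    obtain ⟨x, hx⟩ := hne i hi
    have := hone x i hi hx
    simp [h0] at this
  constructor
  · rintro ⟨he0, he, hmin⟩
    obtain ⟨x, hx⟩ := hexists e he0
    obtain ⟨i, hi, hR⟩ := hcover x
    refine ⟨i, hi, ?_⟩
    have hmul : e * E i = E i := by
      refine sub_eq_zero.mp (hψ _ fun y => ?_)
      by_cases hy : R y i
      · simp [hone y i hi hy, hconst i hi x y hR hy e (hval e x he hx)]
      · simp [hzero y i hi hy]
    by_contra hne'
    refine hmin ⟨E i, e - E i, hEne i hi, sub_ne_zero.mpr hne', hidem i hi, ?_, ?_, by ring⟩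
    · linear_combination he - 2 * hmul + hidem i hi
    · linear_combination hmul - hidem i hi
  · rintro ⟨i, hi, rfl⟩
    refine ⟨hEne i hi, hidem i hi, ?_⟩
    rintro ⟨e₁, e₂, h1, h2, hi1, hi2, hmul, hsum⟩
    obtain ⟨x, hx⟩ := hexists e₁ h1
    obtain ⟨y, hy⟩ := hexists e₂ h2
    replace hx := hval _ _ hi1 hx
    replace hy := hval _ _ hi2 hy
    have hx2 : ψ x e₂ = 0 := by simpa [hx] using congrArg (ψ x) hmul
    have hy1 : ψ y e₁ = 0 := by simpa [hy] using congrArg (ψ y) hmul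
    have hRx : R x i := by
      by_contra h
      have := congrArg (ψ x) hsum
      simp [hzero x i hi h, hx, hx2] at this
    have hRy : R y i := by
      by_contra h
      have := congrArg (ψ y) hsum
      simp [hzero y i hi h, hy, hy1] at this
    exact zero_ne_one (hy1.symm.trans (hconst i hi x y hRx hRy e₁ hx))

/-- The homomorphisms from `F[X]/(f)` to an algebraic closure separate points when `f` is
separable. -/
theorem AdjoinRoot.eq_zero_of_forall_algHom {F Ω : Type*} [Field F] [Field Ω] [Algebra F Ω]
    [IsAlgClosed Ω] {f : F[X]} (hf : f.Separable) (z : AdjoinRoot f)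
    (hz : ∀ ψ : AdjoinRoot f →ₐ[F] Ω, ψ z = 0) : z = 0 := by
  induction z using AdjoinRoot.induction_on with
  | ih p =>
    rw [AdjoinRoot.mk_eq_zero]
    by_cases hp : p = 0
    · simp [hp]
    rw [← Polynomial.map_dvd_map' (algebraMap F Ω)]
    refine (IsAlgClosed.splits _).dvd_of_roots_le_roots (by simpa using hf.ne_zero) ?_
    refine (Multiset.le_iff_subset (nodup_roots hf.map)).mpr fun x hx => ?_
    have hx' : aeval x f = 0 := (mem_aroots.mp hx).2
    have := hz (AdjoinRoot.liftAlgHom f (Algebra.ofId F Ω) x hx')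
    exact mem_aroots.mpr ⟨hp,
      (AdjoinRoot.liftAlgHom_mk f (Algebra.ofId F Ω) x hx' p).symm.trans this⟩

theorem isConjRoot_inv {F Ω : Type*} [Field F] [Field Ω] [Algebra F Ω] {u : Ω} (hu0 : u ≠ 0)
    (hu : u ∉ Set.range (algebraMap F Ω)) {w : F} (hw : algebraMap F Ω w = u + u⁻¹) :
    IsConjRoot F u u⁻¹ := by
  have hroot : ∀ v : Ω, aeval v (X ^ 2 - C w * X + 1 : F[X]) = (v - u) * (v - u⁻¹) := fun v => by
    simp only [map_add, map_sub, map_mul, map_pow, aeval_X, aeval_C, map_one, hw]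
    linear_combination -mul_inv_cancel₀ hu0
  have hmonic : (X ^ 2 - C w * X + 1 : F[X]).Monic := by monicity!
  have hdeg : (X ^ 2 - C w * X + 1 : F[X]).natDegree = 2 := by compute_degree!
  have hint : IsIntegral F u := ⟨_, hmonic, by simpa using hroot u⟩
  have hmin : X ^ 2 - C w * X + 1 = minpoly F u :=
    eq_of_monic_of_dvd_of_natDegree_le (minpoly.monic hint) hmonic
      (minpoly.dvd F u (by simpa using hroot u))
      (hdeg.le.trans ((minpoly.two_le_natDegree_iff hint).mpr hu))
  exact isConjRoot_of_aeval_eq_zero hint (by rw [← hmin, hroot]; simp)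

section TwoPowerRoots

variable {K : Type*} [Field K] {ε : ℕ → AlgebraicClosure K}

theorem InK.sq_eq_one_of_pow_eq_one (hi : ε 2 ^ 2 = -1) (hε2 : ¬InK K (ε 2)) (k : ℕ)
    {u : AlgebraicClosure K} (hu : InK K u) (h : u ^ 2 ^ k = 1) : u ^ 2 = 1 := by
  induction k generalizing u with
  | zero => simp_all
  | succ k ih =>
    obtain ⟨v, rfl⟩ := hu
    have h4 := ih (u := algebraMap K _ v ^ 2) ⟨v ^ 2, map_pow _ _ _⟩
      (by rw [← pow_mul, ← pow_succ', h])
    rcases mul_self_eq_one_iff.mp ((sq _).symm.trans h4) with h4 | h4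
    · exact h4
    · exfalso
      rcases sq_eq_sq_iff_eq_or_eq_neg.mp (hi.trans h4.symm) with h5 | h5
      · exact hε2 ⟨v, h5.symm⟩
      · exact hε2 ⟨-v, by rw [map_neg, h5]⟩

theorem inK_add_inv_of_le (hprim : ∀ n : ℕ, IsPrimitiveRoot (ε n) (2 ^ n))
    (hcomp : ∀ n : ℕ, ε (n + 1) ^ 2 = ε n) {l s : ℕ} (hls : l ≤ s)
    (h : InK K (ε s + (ε s)⁻¹)) : InK K (ε l + (ε l)⁻¹) := by
  induction s, hls using Nat.le_induction with
  | base => exact h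
  | succ s _ ih =>
    refine ih ?_
    obtain ⟨c, hc⟩ := h
    have hz : ε (s + 1) * (ε (s + 1))⁻¹ = 1 := mul_inv_cancel₀ ((hprim _).ne_zero (by positivity))
    refine ⟨c ^ 2 - 2, ?_⟩
    rw [map_sub, map_pow, hc, ← hcomp s, map_ofNat, ← inv_pow]
    linear_combination 2 * hz

theorem inK_add_inv_of_type {s m : ℕ} (hprim : ∀ n : ℕ, IsPrimitiveRoot (ε n) (2 ^ n))
    (hcomp : ∀ n : ℕ, ε (n + 1) ^ 2 = ε n)
    (hcase : (TypeC K ε ∧ 1 ≤ s) ∨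
      ((TypeDc K ε m ∨ TypeEc K ε m) ∧ 1 ≤ s ∧ s ≤ m - 1)) : InK K (ε s + (ε s)⁻¹) := by
  rcases hcase with ⟨h, -⟩ | ⟨h | h, h1, hs⟩
  · exact h.2 s
  · exact inK_add_inv_of_le hprim hcomp (by lia : s ≤ m) h.2.2.1
  · refine inK_add_inv_of_le hprim hcomp hs ?_
    obtain ⟨-, hm, c, hc⟩ := h
    obtain ⟨k, rfl⟩ : ∃ k, m = k + 1 := ⟨m - 1, by lia⟩
    have hz : ε (k + 1) * (ε (k + 1))⁻¹ = 1 :=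
      mul_inv_cancel₀ ((hprim _).ne_zero (by positivity))
    refine ⟨c ^ 2 + 2, ?_⟩
    rw [Nat.add_sub_cancel, map_add, map_pow, hc, ← hcomp k, map_ofNat, ← inv_pow]
    linear_combination -2 * hz

theorem mem_adjoin_of_inK_add_inv (hprim : ∀ n : ℕ, IsPrimitiveRoot (ε n) (2 ^ n))
    (hcomp : ∀ n : ℕ, ε (n + 1) ^ 2 = ε n) {s : ℕ} (h : InK K (ε s + (ε s)⁻¹)) :
    ε s ∈ K⟮ε 2⟯ := by
  have h2mem : ε 2 ∈ K⟮ε 2⟯ := mem_adjoin_simple_self K _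
  rcases le_total s 2 with hs | hs
  · have h1mem : ε 1 ∈ K⟮ε 2⟯ := hcomp 1 ▸ pow_mem h2mem 2
    interval_cases s
    · exact hcomp 0 ▸ pow_mem h1mem 2
    · exact h1mem
    · exact h2mem
  · induction s, hs using Nat.le_induction with
    | base => exact h2mem
    | succ s hs ih =>
      have hmem := ih (inK_add_inv_of_le hprim hcomp s.le_succ h)
      obtain ⟨c, hc⟩ := h
      have hz0 : ε (s + 1) ≠ 0 := (hprim _).ne_zero (by positivity)
      have hmul : ε (s + 1) * algebraMap K _ c = ε s + 1 := by
        rw [hc, ← hcomp s]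
        linear_combination mul_inv_cancel₀ hz0
      have hc0 : algebraMap K (AlgebraicClosure K) c ≠ 0 := fun h0 => by
        rw [h0, mul_zero] at hmul
        have h4 : ε (s + 1) ^ 4 = 1 := by
          rw [show 4 = 2 * 2 from rfl, pow_mul, hcomp, eq_neg_of_add_eq_zero_left hmul.symm]
          norm_num
        refine (hprim (s + 1)).pow_ne_one_of_pos_of_lt (by norm_num) ?_ h4
        calc 4 < 2 ^ 3 := by norm_num
          _ ≤ 2 ^ (s + 1) := Nat.pow_le_pow_right (by norm_num) (by lia)
      rw [eq_div_of_mul_eq hc0 hmul]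
      exact div_mem (add_mem hmem (one_mem _)) (IntermediateField.algebraMap_mem _ _)

theorem isConjRoot_of_pow_eq (hi : ε 2 ^ 2 = -1) {r : ℕ} {x y v : AlgebraicClosure K}
    (hv : v ∈ K⟮ε 2⟯) (hr : r ≠ 0 → ∀ c ∈ K⟮ε 2⟯, c ^ 2 ≠ v) (hx : x ^ 2 ^ r = v)
    (hy : y ^ 2 ^ r = v) : IsConjRoot K x y := by
  rcases eq_or_ne r 0 with rfl | hr0
  · simp only [pow_zero, pow_one] at hx hy
    rw [hx, hy]
  have hirr : Irreducible (X ^ 2 ^ r - C (⟨v, hv⟩ : K⟮ε 2⟯)) :=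
    X_pow_two_pow_sub_C_irreducible
      ⟨⟨ε 2, mem_adjoin_simple_self K _⟩, Subtype.ext (by simpa using hi)⟩ r
      fun c hc => hr hr0 c c.2 (by simpa using congrArg Subtype.val hc)
  have hmonic := monic_X_pow_sub_C (⟨v, hv⟩ : K⟮ε 2⟯) (pow_ne_zero r two_ne_zero)
  have hmin : ∀ t : AlgebraicClosure K, t ^ 2 ^ r = v →
      X ^ 2 ^ r - C (⟨v, hv⟩ : K⟮ε 2⟯) = minpoly K⟮ε 2⟯ t := fun t ht =>
    minpoly.eq_of_irreducible_of_monic hirr (by simp [ht, IntermediateField.algebraMap_apply]) hmonic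
  exact IsConjRoot.of_isScalarTower (L := K⟮ε 2⟯) (Algebra.IsIntegral.isIntegral x)
    ((hmin x hx).symm.trans (hmin y hy))

end TwoPowerRoots

end Auxiliary

/-- Theorem 3, case 2): `ε₂ ∉ K`, `a ∈ K*^{2^s}`, and either `K` is of type C with
`s ≥ 1`, or of type D or E with constant `m` and `1 ≤ s ≤ m - 1`.  Then the
coefficients `ε_s^{ij} + ε_s^{-ij}` lie in `K` and the minimal idempotents of
`A = K[X]/(X^{2^n} - a)` are exactly `e_0`, `e_{2^{s-1}}` and
`e_i = (1/2^s)·Σ_j (ε_s^{ij} + ε_s^{-ij})·(b⁻¹·ḡ^{2^{n-s}})^j`, `1 ≤ i ≤ 2^{s-1} - 1`. -/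
theorem stmt_16 (K : Type*) [Field K] (h2 : (2 : K) ≠ 0)
    (ε : ℕ → AlgebraicClosure K)
    (hprim : ∀ n : ℕ, IsPrimitiveRoot (ε n) (2 ^ n))
    (hcomp : ∀ n : ℕ, ε (n + 1) ^ 2 = ε n)
    (hε2 : ¬InK K (ε 2))
    (n : ℕ) (hn : 1 ≤ n) (a : K) (ha : a ≠ 0)
    -- `s = H_n(a)`:
    (s : ℕ) (hsn : s ≤ n) (hmem : MemKs K ε s a)
    (hmax : ∀ t : ℕ, t ≤ n → MemKs K ε t a → t ≤ s)
    (m : ℕ)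
    (hcase : (TypeC K ε ∧ 1 ≤ s) ∨
      ((TypeDc K ε m ∨ TypeEc K ε m) ∧ 1 ≤ s ∧ s ≤ m - 1))
    -- `a ∈ K*^{2^s}`, written `a = b^{2^s}`:
    (b : K) (hb : b ≠ 0) (hab : a = b ^ 2 ^ s)
    -- `ḡ` is the image of `X` in `A = K[X]/(X^{2^n} - a)`:
    (g : AdjoinRoot (Polynomial.X ^ 2 ^ n - Polynomial.C a))
    (hg : g = AdjoinRoot.root (Polynomial.X ^ 2 ^ n - Polynomial.C a))
    (φ : K →+* AdjoinRoot (Polynomial.X ^ 2 ^ n - Polynomial.C a))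
    (hφ : φ = algebraMap K (AdjoinRoot (Polynomial.X ^ 2 ^ n - Polynomial.C a))) :
    ∃ w : ℕ → ℕ → K,
      (∀ i j : ℕ, algebraMap K (AlgebraicClosure K) (w i j) =
        ε s ^ (i * j) + (ε s)⁻¹ ^ (i * j)) ∧
      ∀ e : AdjoinRoot (Polynomial.X ^ 2 ^ n - Polynomial.C a),
        IsMinIdem e ↔
          (e = φ (1 / 2 ^ s) *
              ∑ j ∈ Finset.range (2 ^ s), (φ b⁻¹ * g ^ 2 ^ (n - s)) ^ j ∨
          e = φ (1 / 2 ^ s) *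
              ∑ j ∈ Finset.range (2 ^ s), φ ((-1) ^ j) * (φ b⁻¹ * g ^ 2 ^ (n - s)) ^ j ∨
          ∃ i : ℕ, 1 ≤ i ∧ i ≤ 2 ^ (s - 1) - 1 ∧
            e = φ (1 / 2 ^ s) *
              ∑ j ∈ Finset.range (2 ^ s), φ (w i j) * (φ b⁻¹ * g ^ 2 ^ (n - s)) ^ j) := by
  classical
  subst hg hφ
  obtain ⟨k, rfl⟩ : ∃ k, s = k + 1 := ⟨s - 1, by lia⟩
  have hs := inK_add_inv_of_type hprim hcomp hcase
  have hi : ε 2 ^ 2 = -1 := by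
    rw [hcomp]
    exact (hprim 1).eq_neg_one_of_two_right
  have hζL := mem_adjoin_of_inK_add_inv hprim hcomp hs
  have hζ := hprim (k + 1)
  set ζ := ε (k + 1) with hζdef
  have hζ0 : ζ ≠ 0 := hζ.ne_zero (by positivity)
  have hζhalf : ζ ^ 2 ^ k = -1 :=
    (hζ.pow (by positivity) (pow_succ 2 k)).eq_neg_one_of_two_right
  have hw : ∀ i : ℕ, ∃ c : K, algebraMap K (AlgebraicClosure K) c = ζ ^ i + ζ⁻¹ ^ i := fun i =>
    pow_add_inv_pow_mem (algebraMap K (AlgebraicClosure K)).range hζ0 hs i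
  choose w hw using hw
  refine ⟨fun i j => w (i * j), fun i j => hw (i * j), ?_⟩
  set f : Polynomial K := Polynomial.X ^ 2 ^ n - Polynomial.C a with hf
  intro e
  have h2' : (2 : AlgebraicClosure K) ≠ 0 := by
    have := (map_ne_zero (algebraMap K (AlgebraicClosure K))).mpr h2
    rwa [map_ofNat] at this
  have hb' : algebraMap K (AlgebraicClosure K) b ≠ 0 := by simpa using hb
  set Y : AdjoinRoot f :=
    algebraMap K (AdjoinRoot f) b⁻¹ * AdjoinRoot.root f ^ 2 ^ (n - (k + 1)) with hY
  have hsep : f.Separable := Polynomial.separable_X_pow_sub_C a (by simp [h2]) ha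
  have hψY : ∀ ψ : AdjoinRoot f →ₐ[K] AlgebraicClosure K,
      ψ (AdjoinRoot.root f) ^ 2 ^ (n - (k + 1)) = algebraMap K _ b * ψ Y := fun ψ => by
    rw [hY, map_mul, AlgHom.commutes, map_pow, map_inv₀, mul_inv_cancel_left₀ hb']
  have hψq : ∀ ψ : AdjoinRoot f →ₐ[K] AlgebraicClosure K, ψ Y ^ 2 ^ (k + 1) = 1 := fun ψ => by
    have hroot : ψ (AdjoinRoot.root f) ^ 2 ^ n = algebraMap K _ a := by
      have h := congrArg ψ (AdjoinRoot.eval₂_root f)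
      simpa [hf, sub_eq_zero, ← AdjoinRoot.algebraMap_eq] using h
    have hpow := congrArg (· ^ 2 ^ (k + 1)) (hψY ψ)
    simp only [← pow_mul, ← pow_add, Nat.sub_add_cancel hsn, mul_pow] at hpow
    rw [hroot, hab, map_pow] at hpow
    exact (mul_eq_left₀ (pow_ne_zero _ hb')).mp hpow.symm
  have hnonsq : ∀ u : AlgebraicClosure K, u ^ 2 ^ (k + 1) = 1 → n - (k + 1) ≠ 0 →
      ∀ c ∈ IntermediateField.adjoin K {ε 2}, c ^ 2 ≠ algebraMap K _ b * u := by
    intro u hu hn0 c hc hcu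
    have hcpow : algebraMap K (AlgebraicClosure K) a = c ^ 2 ^ (k + 1 + 1) := by
      rw [pow_succ' 2 (k + 1), pow_mul, hcu, mul_pow, hu, mul_one, hab, map_pow]
    have hc0 : c ≠ 0 := by
      rintro rfl
      rw [zero_pow (by positivity)] at hcpow
      exact ha (by simpa using hcpow)
    have := hmax (k + 1 + 1) (by lia) ⟨c, hc, hc0, hcpow⟩
    lia
  have hpowL : ∀ i : ℕ, algebraMap K (AlgebraicClosure K) b * ζ ^ i ∈
      IntermediateField.adjoin K {ε 2} := fun i =>
    mul_mem (IntermediateField.algebraMap_mem _ b) (pow_mem hζL i)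
  have hζpow : ∀ i : ℕ, (ζ ^ i) ^ 2 ^ (k + 1) = 1 := fun i => by
    rw [← pow_mul, mul_comm, pow_mul, hζ.pow_eq_one, one_pow]
  have hconj_eq : ∀ (i : ℕ) (x y : AlgebraicClosure K),
      x ^ 2 ^ (n - (k + 1)) = algebraMap K _ b * ζ ^ i →
      y ^ 2 ^ (n - (k + 1)) = algebraMap K _ b * ζ ^ i → IsConjRoot K x y := fun i x y =>
    isConjRoot_of_pow_eq hi (hpowL i) (hnonsq _ (hζpow i))
  have hconj_inv : ∀ (i : ℕ) (x y : AlgebraicClosure K),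
      x ^ 2 ^ (n - (k + 1)) = algebraMap K _ b * ζ ^ i →
      y ^ 2 ^ (n - (k + 1)) = algebraMap K _ b * ζ⁻¹ ^ i → IsConjRoot K y x := by
    intro i x y hx hy
    by_cases hK : InK K (ζ ^ i)
    · have h1 := InK.sq_eq_one_of_pow_eq_one hi hε2 (k + 1) hK (hζpow i)
      have h3 : ζ⁻¹ ^ i = ζ ^ i := by
        rw [inv_pow, inv_eq_iff_eq_inv]
        exact eq_inv_of_mul_eq_one_left (by rw [← sq, h1])
      exact hconj_eq i _ _ (h3 ▸ hy) hx
    · obtain ⟨σ, hσ⟩ :=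
        (isConjRoot_inv (pow_ne_zero i hζ0) hK (by rw [hw, inv_pow])).exists_algEquiv
      refine IsConjRoot.trans (isConjRoot_of_algEquiv y σ) (hconj_eq i _ _ ?_ hx)
      rw [← map_pow, hy, map_mul, AlgEquiv.commutes, inv_pow, hσ]
  have hconj : ∀ (i : ℕ) (x y : AlgebraicClosure K),
      (x ^ 2 ^ (n - (k + 1)) = algebraMap K _ b * ζ ^ i ∨
        x ^ 2 ^ (n - (k + 1)) = algebraMap K _ b * ζ⁻¹ ^ i) →
      (y ^ 2 ^ (n - (k + 1)) = algebraMap K _ b * ζ ^ i ∨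
        y ^ 2 ^ (n - (k + 1)) = algebraMap K _ b * ζ⁻¹ ^ i) → IsConjRoot K x y := by
    intro i x y hx hy
    obtain ⟨z, hz⟩ := IsAlgClosed.exists_pow_nat_eq (algebraMap K (AlgebraicClosure K) b * ζ ^ i)
      (show 0 < 2 ^ (n - (k + 1)) by positivity)
    have hto : ∀ t : AlgebraicClosure K, (t ^ 2 ^ (n - (k + 1)) = algebraMap K _ b * ζ ^ i ∨
        t ^ 2 ^ (n - (k + 1)) = algebraMap K _ b * ζ⁻¹ ^ i) → IsConjRoot K t z := fun t ht =>
      ht.elim (fun h => hconj_eq i _ _ h hz) (fun h => hconj_inv i _ _ hz h)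
    exact (hto x hx).trans (hto y hy).symm
  let E : ℕ → AdjoinRoot f := fun i =>
    if i = 0 then algebraMap K (AdjoinRoot f) (1 / 2 ^ (k + 1)) *
      ∑ j ∈ Finset.range (2 ^ (k + 1)), Y ^ j
    else if i = 2 ^ k then algebraMap K (AdjoinRoot f) (1 / 2 ^ (k + 1)) *
      ∑ j ∈ Finset.range (2 ^ (k + 1)), algebraMap K (AdjoinRoot f) ((-1) ^ j) * Y ^ j
    else algebraMap K (AdjoinRoot f) (1 / 2 ^ (k + 1)) *
      ∑ j ∈ Finset.range (2 ^ (k + 1)), algebraMap K (AdjoinRoot f) (w (i * j)) * Y ^ j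
  have hval : ∀ (ψ : AdjoinRoot f →ₐ[K] AlgebraicClosure K), ∀ i ≤ 2 ^ k,
      ψ (E i) = if ψ Y = ζ ^ i ∨ ψ Y = ζ⁻¹ ^ i then 1 else 0 := by
    intro ψ i hik
    have hinv : ∀ v : AlgebraicClosure K, v ^ 2 ^ (k + 1) = 1 →
        1 / 2 ^ (k + 1) * ∑ j ∈ Finset.range (2 ^ (k + 1)), (v * ψ Y) ^ j =
          if ψ Y = v⁻¹ then 1 else 0 := by
      intro v hv
      have hv0 : v ≠ 0 := by
        rintro rfl
        simp at hv
      rw [geom_sum_of_pow_eq_one (by rw [mul_pow, hv, hψq, one_mul])]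
      have hiff : v * ψ Y = 1 ↔ ψ Y = v⁻¹ :=
        ⟨eq_inv_of_mul_eq_one_right, fun h => by rw [h, mul_inv_cancel₀ hv0]⟩
      simp only [hiff]
      split_ifs <;> simp [h2']
    rcases eq_or_ne i 0 with rfl | h0
    · have h := hinv 1 (one_pow _)
      simp only [one_mul] at h
      simp only [E, if_true, map_mul, AlgHom.commutes, map_sum, map_pow, map_div₀, map_one,
        map_ofNat, h, pow_zero, inv_one, or_self]
    rcases eq_or_ne i (2 ^ k) with rfl | hne
    · have h := hinv (-1) (by rw [← hζhalf, hζpow])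
      simp only [mul_pow] at h
      simp only [E, if_neg h0, if_true, map_mul, AlgHom.commutes, map_sum, map_pow, map_div₀,
        map_one, map_neg, map_ofNat, h, inv_pow, hζhalf, inv_neg, inv_one, or_self]
    · have hdisj : ζ ^ i ≠ ζ⁻¹ ^ i := fun h => by
        refine hζ.pow_ne_one_of_pos_of_lt (l := i + i) (by lia) (by lia) ?_
        rw [pow_add]
        nth_rewrite 2 [h]
        rw [← mul_pow, mul_inv_cancel₀ hζ0, one_pow]
      have h1 := hinv (ζ ^ i) (hζpow i)
      have h2 := hinv (ζ⁻¹ ^ i) (by rw [inv_pow, inv_pow, hζpow, inv_one])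
      have hE : ψ (E i) = 1 / 2 ^ (k + 1) * ∑ j ∈ Finset.range (2 ^ (k + 1)), (ζ ^ i * ψ Y) ^ j +
          1 / 2 ^ (k + 1) * ∑ j ∈ Finset.range (2 ^ (k + 1)), (ζ⁻¹ ^ i * ψ Y) ^ j := by
        simp only [E, if_neg h0, if_neg hne, map_mul, AlgHom.commutes, map_sum, map_pow, hw,
          map_div₀, map_one, map_ofNat, ← mul_add, ← Finset.sum_add_distrib]
        simp only [mul_pow, ← pow_mul, add_mul]
      rw [hE, h1, h2, ← inv_pow, ← inv_pow, inv_inv]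
      by_cases hA : ψ Y = ζ ^ i
      · simp only [hA, if_neg hdisj, true_or, if_true, zero_add]
      · simp only [hA, false_or, if_false, add_zero]
  have hmain := isMinIdem_iff_of_characters
    (fun ψ : AdjoinRoot f →ₐ[K] AlgebraicClosure K => (ψ : AdjoinRoot f →+* AlgebraicClosure K))
    (fun z hz => AdjoinRoot.eq_zero_of_forall_algHom (Ω := AlgebraicClosure K) hsep z hz)
    {i | i ≤ 2 ^ k} E (fun ψ i => ψ Y = ζ ^ i ∨ ψ Y = ζ⁻¹ ^ i)
    (fun ψ i hik hR => (hval ψ i hik).trans (if_pos hR))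
    (fun ψ i hik hR => (hval ψ i hik).trans (if_neg hR)) ?_ ?_ ?_ e
  · rw [hmain]
    have hpos : 0 < 2 ^ k := by positivity
    constructor
    · rintro ⟨i, hik, rfl⟩
      simp only [E]
      split_ifs with h0 h1
      · exact Or.inl rfl
      · exact Or.inr (Or.inl rfl)
      · refine Or.inr (Or.inr ⟨i, by lia, ?_, rfl⟩)
        rw [Set.mem_ofPred_eq] at hik
        rw [Nat.add_sub_cancel]
        lia
    · rintro (rfl | rfl | ⟨i, h1, hik, rfl⟩)
      · exact ⟨0, hpos.le, by simp only [E, if_true]⟩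
      · exact ⟨2 ^ k, le_refl (2 ^ k), by simp only [E, if_neg hpos.ne', if_true]⟩
      · rw [Nat.add_sub_cancel] at hik
        refine ⟨i, (by lia : i ≤ 2 ^ k), ?_⟩
        simp only [E, if_neg (by lia : i ≠ 0), if_neg (by lia : i ≠ 2 ^ k)]
  · intro ψ
    obtain ⟨i, hi, h⟩ := hζ.eq_pow_of_pow_eq_one (hψq ψ)
    rcases le_total i (2 ^ k) with hik | hik
    · exact ⟨i, hik, Or.inl h.symm⟩
    · refine ⟨2 ^ (k + 1) - i, by simp only [Set.mem_ofPred_eq]; lia, Or.inr ?_⟩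
      rw [← h, inv_pow]
      refine eq_inv_of_mul_eq_one_left ?_
      rw [← pow_add, Nat.add_sub_cancel' hi.le, hζ.pow_eq_one]
  · intro i _
    obtain ⟨z, hz⟩ := IsAlgClosed.exists_pow_nat_eq (algebraMap K (AlgebraicClosure K) b * ζ ^ i)
      (show 0 < 2 ^ (n - (k + 1)) by positivity)
    have hroot : Polynomial.aeval z f = 0 := by
      have : z ^ 2 ^ n = algebraMap K _ a := by
        rw [← Nat.sub_add_cancel hsn, pow_add, pow_mul, hz, mul_pow, hζpow, mul_one, hab, map_pow]
      simp [hf, this]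
    refine ⟨AdjoinRoot.liftAlgHom f (Algebra.ofId K _) z hroot, Or.inl ?_⟩
    have h := hψY (AdjoinRoot.liftAlgHom f (Algebra.ofId K _) z hroot)
    erw [AdjoinRoot.liftAlgHom_root] at h
    rw [hz] at h
    exact (mul_left_cancel₀ hb' h).symm
  · intro i _ ψ ψ' hR hR' e he
    have hc := hconj i (ψ' (AdjoinRoot.root f)) (ψ (AdjoinRoot.root f))
      (by rw [hψY]; exact hR'.imp (congrArg _) (congrArg _))
      (by rw [hψY]; exact hR.imp (congrArg _) (congrArg _))
    obtain ⟨σ, hσ⟩ := hc.exists_algEquiv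
    have hψ' : ψ' = (σ : AlgebraicClosure K →ₐ[K] AlgebraicClosure K).comp ψ :=
      AdjoinRoot.algHom_ext (by simpa using hσ.symm)
    subst hψ'
    simpa using he
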